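/- Let E ⊂ X be a set of finite perimeter and let W′, W ⊂ X be open sets. Suppose that E ⊂ W′ ⊂ W and that E is indecomposable in W′. Then E is indecomposable in W. -/

import Mathlib

open MeasureTheory Metric Filter Set ENNReal NNReal Topology

/-- A curve: a rectifiable continuous map from a compact interval into `X`,
parametrized by arc length (hence `1`-Lipschitz on `[0, len]`). -/
structure Curve (X : Type*) [MetricSpace X] where
  len : ℝ
  len_nonneg : 0 ≤ len
  toFun : ℝ → X
  lipschitzOn : LipschitzOnWith 1 toFun (Set.Icc 0 len)

namespace Curve

variable {X : Type*} [MetricSpace X]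

/-- A curve is nonconstant if it attains two distinct values. -/
def IsNonconstant (γ : Curve X) : Prop :=
  ∃ s ∈ Set.Icc (0:ℝ) γ.len, ∃ t ∈ Set.Icc (0:ℝ) γ.len, γ.toFun s ≠ γ.toFun t

/-- A curve lies in a set `W`. -/
def IsIn (γ : Curve X) (W : Set X) : Prop :=
  ∀ s ∈ Set.Icc (0:ℝ) γ.len, γ.toFun s ∈ W

end Curve

variable {X : Type*} [MetricSpace X] [MeasurableSpace X] [BorelSpace X]

/-- The curve integral `∫_γ g ds` for an arc-length parametrized curve. -/
noncomputable def curveLintegral (g : X → ℝ≥0∞) (γ : Curve X) : ℝ≥0∞ :=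
  ∫⁻ s in Set.Icc (0:ℝ) γ.len, g (γ.toFun s)

/-- The upper gradient inequality `|u(x) - u(y)| ≤ ∫_γ g ds` along a curve `γ`
with endpoints `x, y`. -/
def UpperGradIneq (g : X → ℝ≥0∞) (u : X → ℝ) (γ : Curve X) : Prop :=
  ENNReal.ofReal |u (γ.toFun 0) - u (γ.toFun γ.len)| ≤ curveLintegral g γ

/-- The 1-modulus of a family of curves. -/
noncomputable def mod1 (μ : Measure X) (Γ : Set (Curve X)) : ℝ≥0∞ :=
  ⨅ (ρ : X → ℝ≥0∞) (_ : Measurable ρ ∧ ∀ γ ∈ Γ, 1 ≤ curveLintegral ρ γ),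
    ∫⁻ x, ρ x ∂μ

/-- `g` is a 1-weak upper gradient of `u` in `W`: the upper gradient inequality
holds for all nonconstant curves in `W` outside a family of 1-modulus zero. -/
def IsWeakUpperGradientOn (μ : Measure X) (g : X → ℝ≥0∞) (u : X → ℝ) (W : Set X) : Prop :=
  Measurable g ∧
    mod1 μ {γ : Curve X | γ.IsNonconstant ∧ γ.IsIn W ∧ ¬ UpperGradIneq g u γ} = 0

/-- `g` is a (strong) upper gradient of `u` in `X`. -/
def IsUpperGradient (g : X → ℝ≥0∞) (u : X → ℝ) : Prop :=
  Measurable g ∧ ∀ γ : Curve X, γ.IsNonconstant → UpperGradIneq g u γ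

/-- `∫_W g_u dμ`: the integral over `W` of the minimal 1-weak upper gradient of `u`
in `W`, equivalently the infimum of `∫_W g dμ` over all 1-weak upper gradients `g`
of `u` in `W`. -/
noncomputable def gradEnergy (μ : Measure X) (u : X → ℝ) (W : Set X) : ℝ≥0∞ :=
  ⨅ (g : X → ℝ≥0∞) (_ : IsWeakUpperGradientOn μ g u W), ∫⁻ x in W, g x ∂μ

/-- `u` is locally Lipschitz on `W`. -/
def LocLipschitzOn (u : X → ℝ) (W : Set X) : Prop :=
  ∀ x ∈ W, ∃ K : ℝ≥0, ∃ t ∈ nhdsWithin x W, LipschitzOnWith K u t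

/-- Convergence `uᵢ → v` in `L¹_loc(W)`. -/
def TendstoL1loc (μ : Measure X) (W : Set X) (u : ℕ → X → ℝ) (v : X → ℝ) : Prop :=
  ∀ W' : Set X, IsOpen W' → IsCompact (closure W') → closure W' ⊆ W →
    Tendsto (fun i => ∫⁻ x in W', ENNReal.ofReal |u i x - v x| ∂μ) atTop (𝓝 0)

/-- The total variation `‖Dv‖(W)` of a function `v` in an open set `W`. -/
noncomputable def variationOn (μ : Measure X) (v : X → ℝ) (W : Set X) : ℝ≥0∞ :=
  ⨅ (u : ℕ → X → ℝ) (_ : (∀ i, LocLipschitzOn (u i) W) ∧ TendstoL1loc μ W u v),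
    Filter.liminf (fun i => gradEnergy μ (u i) W) Filter.atTop

/-- The total variation `‖Dv‖(A)` of a function `v` in an arbitrary set `A`. -/
noncomputable def totalVar (μ : Measure X) (v : X → ℝ) (A : Set X) : ℝ≥0∞ :=
  ⨅ (W : Set X) (_ : IsOpen W ∧ A ⊆ W), variationOn μ v W

/-- The perimeter `P(E, A) = ‖Dχ_E‖(A)`. -/
noncomputable def perimeter (μ : Measure X) (E A : Set X) : ℝ≥0∞ :=
  totalVar μ (Set.indicator E fun _ => (1 : ℝ)) A

/-- The measure `μ` is doubling. -/
def IsDoublingMeasure (μ : Measure X) : Prop :=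
  ∃ C : ℝ≥0∞, 1 ≤ C ∧ ∀ (x : X) (r : ℝ), 0 < r → μ (ball x (2 * r)) ≤ C * μ (ball x r)

/-- The space supports a (1,1)-Poincaré inequality:
`⨍_{B(x,r)} |u - u_{B(x,r)}| dμ ≤ C r ⨍_{B(x,λr)} g dμ` for every ball, every
`u ∈ L¹_loc(X)` and every upper gradient `g` of `u` (stated here multiplied
through by the measures of the two balls). -/
def SupportsPoincare (μ : Measure X) : Prop :=
  ∃ C lam : ℝ, 0 < C ∧ 1 ≤ lam ∧
    ∀ (x : X) (r : ℝ), 0 < r → ∀ (u : X → ℝ) (g : X → ℝ≥0∞),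
      (∀ (y : X) (s : ℝ), IntegrableOn u (ball y s) μ) → IsUpperGradient g u →
        μ (ball x (lam * r)) *
            ∫⁻ y in ball x r, ENNReal.ofReal |u y - ⨍ z in ball x r, u z ∂μ| ∂μ ≤
          ENNReal.ofReal (C * r) * μ (ball x r) * ∫⁻ y in ball x (lam * r), g y ∂μ

/-- `(X, d, μ)` is a PI space: complete, doubling, supporting a (1,1)-Poincaré
inequality. -/
def IsPISpace (μ : Measure X) : Prop :=
  CompleteSpace X ∧ IsDoublingMeasure μ ∧ SupportsPoincare μ

/-- A set `E` of finite perimeter is decomposable in a Borel set `D` if there is a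
partition `{F, G}` of `E ∩ D` into sets of finite perimeter in `D`, both of positive
measure, with `P(E,D) = P(F,D) + P(G,D)`. -/
def IsDecomposableIn (μ : Measure X) (E D : Set X) : Prop :=
  ∃ F G : Set X, MeasurableSet F ∧ MeasurableSet G ∧ Disjoint F G ∧ F ∪ G = E ∩ D ∧
    perimeter μ F D < ⊤ ∧ perimeter μ G D < ⊤ ∧ 0 < μ F ∧ 0 < μ G ∧
    perimeter μ E D = perimeter μ F D + perimeter μ G D

/-- `E` is indecomposable in `D`. -/
def IsIndecomposableIn (μ : Measure X) (E D : Set X) : Prop :=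
  ¬ IsDecomposableIn μ E D

/-- `{F i}_{i ∈ I}` is a (finite or countable) partition of `E` into indecomposable
Borel sets of positive measure and finite perimeter whose perimeters sum to `P(E,X)`;
this is the defining property of the essential connected components `𝒞𝒞ᵉ(E)`. -/
def IsEssentialPartition (μ : Measure X) (E : Set X) (I : Set ℕ) (F : ℕ → Set X) : Prop :=
  (∀ i ∈ I, MeasurableSet (F i)) ∧
  (∀ i ∈ I, ∀ j ∈ I, i ≠ j → Disjoint (F i) (F j)) ∧
  (⋃ i ∈ I, F i) = E ∧
  (∀ i ∈ I, 0 < μ (F i)) ∧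
  (∀ i ∈ I, perimeter μ (F i) Set.univ < ⊤) ∧
  (∀ i ∈ I, IsIndecomposableIn μ (F i) Set.univ) ∧
  perimeter μ E Set.univ = ∑' i : I, perimeter μ (F i.1) Set.univ

/-- Given a decomposition `{G i}_{i ∈ I}` of `X ∖ E` into essential connected
components, the saturation of `E`: the union of `E` and its holes, i.e. the
components of finite measure. -/
def saturationOf (μ : Measure X) (E : Set X) (I : Set ℕ) (G : ℕ → Set X) : Set X :=
  E ∪ ⋃ (i : ℕ) (_ : i ∈ I ∧ μ (G i) < ⊤), G i

/-- The measure-theoretic boundary `∂* E`: points where both `E` and its complement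
have strictly positive upper density. -/
def mtBoundary (μ : Measure X) (E : Set X) : Set X :=
  {x : X |
    0 < Filter.limsup (fun r => μ (ball x r ∩ E) / μ (ball x r)) (nhdsWithin 0 (Set.Ioi 0)) ∧
    0 < Filter.limsup (fun r => μ (ball x r \ E) / μ (ball x r)) (nhdsWithin 0 (Set.Ioi 0))}

/-- The restricted codimension-one Hausdorff content `ℋ_R`. -/
noncomputable def codimOneContent (μ : Measure X) (R : ℝ) (A : Set X) : ℝ≥0∞ :=
  ⨅ (s : Set (X × ℝ))
    (_ : s.Countable ∧ (∀ p ∈ s, 0 < p.2 ∧ p.2 ≤ R) ∧ A ⊆ ⋃ p ∈ s, ball p.1 p.2),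
    ∑' p : s, μ (ball (p : X × ℝ).1 (p : X × ℝ).2) / ENNReal.ofReal (p : X × ℝ).2

/-- The codimension-one Hausdorff measure `ℋ(A) = lim_{R → 0} ℋ_R(A)`. -/
noncomputable def codimOneHausdorff (μ : Measure X) (A : Set X) : ℝ≥0∞ :=
  ⨆ (R : ℝ) (_ : 0 < R), codimOneContent μ R A

set_option linter.unusedSectionVars false

/-- `g` is an upper gradient of `u` along every curve lying in `W`. -/
def IsUpperGradientOn (g : X → ℝ≥0∞) (u : X → ℝ) (W : Set X) : Prop :=
  Measurable g ∧ ∀ γ : Curve X, γ.IsIn W → UpperGradIneq g u γ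

lemma IsUpperGradientOn.mono {g : X → ℝ≥0∞} {u : X → ℝ} {W W' : Set X}
    (h : IsUpperGradientOn g u W) (hW : W' ⊆ W) : IsUpperGradientOn g u W' :=
  ⟨h.1, fun γ hγ => h.2 γ fun s hs => hW (hγ s hs)⟩

lemma curveLintegral_add_le (g h : X → ℝ≥0∞) (γ : Curve X) :
    curveLintegral g γ + curveLintegral h γ ≤ curveLintegral (fun x => g x + h x) γ :=
  le_lintegral_add _ _

lemma sum_lintegral_le {α ι : Type*} [MeasurableSpace α] (ν : Measure α) (s : Finset ι)
    (f : ι → α → ℝ≥0∞) : ∑ k ∈ s, ∫⁻ x, f k x ∂ν ≤ ∫⁻ x, ∑ k ∈ s, f k x ∂ν := by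
  classical
  induction s using Finset.induction_on with
  | empty => simp
  | insert a s ha ih =>
    simp only [Finset.sum_insert ha]
    exact (add_le_add le_rfl ih).trans (le_lintegral_add _ _)

lemma gradEnergy_le {μ : Measure X} {g : X → ℝ≥0∞} {u : X → ℝ} {W : Set X}
    (h : IsUpperGradientOn g u W) : gradEnergy μ u W ≤ ∫⁻ x in W, g x ∂μ := by
  refine iInf₂_le g ⟨h.1, le_antisymm ?_ bot_le⟩
  refine (iInf₂_le (fun _ => 0) ⟨measurable_const, fun γ hγ => ?_⟩).trans (by simp)
  exact absurd (h.2 γ hγ.2.1) hγ.2.2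

/-- A family of curves of zero 1-modulus is contained in the family of curves along which
some measurable function of arbitrarily small integral has infinite integral. -/
lemma exists_curveLintegral_eq_top {μ : Measure X} {Γ : Set (Curve X)} (h : mod1 μ Γ = 0)
    {ε : ℝ≥0∞} (hε : ε ≠ 0) :
    ∃ ρ : X → ℝ≥0∞, Measurable ρ ∧ ∫⁻ x, ρ x ∂μ ≤ ε ∧ ∀ γ ∈ Γ, curveLintegral ρ γ = ⊤ := by
  obtain ⟨δ, hδ, hδε⟩ := ENNReal.exists_pos_sum_of_countable' hε ℕ
  have hex : ∀ n, ∃ ρ : X → ℝ≥0∞, (Measurable ρ ∧ ∀ γ ∈ Γ, 1 ≤ curveLintegral ρ γ) ∧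
      ∫⁻ x, ρ x ∂μ < δ n := by
    intro n
    have : mod1 μ Γ < δ n := h ▸ hδ n
    simpa [mod1, iInf_lt_iff] using this
  choose ρ hρ hρδ using hex
  refine ⟨fun x => ∑' n, ρ n x, Measurable.tsum fun n => (hρ n).1, ?_, fun γ hγ => ?_⟩
  · rw [lintegral_tsum fun n => (hρ n).1.aemeasurable]
    exact (ENNReal.tsum_le_tsum fun n => (hρδ n).le).trans hδε.le
  · refine ENNReal.eq_top_of_forall_nnreal_le fun r => ?_
    obtain ⟨N, hN⟩ := exists_nat_ge r
    calc (r : ℝ≥0∞) ≤ N := by exact_mod_cast hN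
      _ = ∑ n ∈ Finset.range N, (1 : ℝ≥0∞) := by simp
      _ ≤ ∑ n ∈ Finset.range N, curveLintegral (ρ n) γ :=
        Finset.sum_le_sum fun n _ => (hρ n).2 γ hγ
      _ ≤ ∫⁻ s in Icc (0:ℝ) γ.len, ∑ n ∈ Finset.range N, ρ n (γ.toFun s) :=
        sum_lintegral_le _ _ _
      _ ≤ _ := lintegral_mono fun s => ENNReal.sum_le_tsum _

lemma exists_isUpperGradientOn {μ : Measure X} {u : X → ℝ} {W : Set X} {b : ℝ≥0∞}
    (h : gradEnergy μ u W < b) :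
    ∃ g : X → ℝ≥0∞, IsUpperGradientOn g u W ∧ ∫⁻ x in W, g x ∂μ < b := by
  simp only [gradEnergy, iInf_lt_iff] at h
  obtain ⟨g, ⟨hg, hmod⟩, hgb⟩ := h
  obtain ⟨c, hgc, hcb⟩ := exists_between hgb
  obtain ⟨ρ, hρ, hρc, hρΓ⟩ := exists_curveLintegral_eq_top hmod (tsub_pos_of_lt hgc).ne'
  refine ⟨fun x => g x + ρ x, ⟨hg.add hρ, fun γ hγ => ?_⟩, ?_⟩
  · by_cases hbad : γ.IsNonconstant ∧ γ.IsIn W ∧ ¬ UpperGradIneq g u γ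
    · refine le_top.trans (le_trans ?_ (curveLintegral_add_le g ρ γ))
      rw [hρΓ γ hbad, add_top]
    · by_cases hc : γ.IsNonconstant
      · have : UpperGradIneq g u γ := by
          by_contra hne
          exact hbad ⟨hc, hγ, hne⟩
        exact this.trans (le_self_add.trans (curveLintegral_add_le g ρ γ))
      · have : γ.toFun 0 = γ.toFun γ.len := by
          by_contra hne
          exact hc ⟨0, ⟨le_rfl, γ.len_nonneg⟩, γ.len, ⟨γ.len_nonneg, le_rfl⟩, hne⟩
        simp [UpperGradIneq, this]
  · rw [lintegral_add_left hg]
    calc _ ≤ ∫⁻ x in W, g x ∂μ + (c - ∫⁻ x in W, g x ∂μ) :=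
          add_le_add le_rfl ((setLIntegral_le_lintegral _ _).trans hρc)
      _ = c := add_tsub_cancel_of_le hgc.le
      _ < b := hcb

lemma LocLipschitzOn.mono {u : X → ℝ} {W W' : Set X} (h : LocLipschitzOn u W) (hW : W' ⊆ W) :
    LocLipschitzOn u W' := by
  intro x hx
  obtain ⟨K, t, ht, hK⟩ := h x (hW hx)
  exact ⟨K, t, nhdsWithin_mono x hW ht, hK⟩

lemma TendstoL1loc.mono {μ : Measure X} {W W' : Set X} {u : ℕ → X → ℝ} {v : X → ℝ}
    (h : TendstoL1loc μ W u v) (hW : W' ⊆ W) : TendstoL1loc μ W' u v :=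
  fun V h1 h2 h3 => h V h1 h2 (h3.trans hW)

lemma variationOn_le_liminf {μ : Measure X} {v : X → ℝ} {u : ℕ → X → ℝ} {W : Set X}
    (hu : ∀ i, LocLipschitzOn (u i) W) (huv : TendstoL1loc μ W u v) :
    variationOn μ v W ≤ liminf (fun i => gradEnergy μ (u i) W) atTop :=
  iInf₂_le u ⟨hu, huv⟩

lemma variationOn_mono {μ : Measure X} {v : X → ℝ} {A B : Set X} (hAB : A ⊆ B) :
    variationOn μ v A ≤ variationOn μ v B := by
  refine le_iInf₂ fun u hu => (variationOn_le_liminf (fun i => (hu.1 i).mono hAB)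
    (hu.2.mono hAB)).trans (liminf_le_liminf (Eventually.of_forall fun i => ?_))
  refine le_of_forall_gt fun b hb => ?_
  obtain ⟨g, hg, hgb⟩ := exists_isUpperGradientOn hb
  exact (gradEnergy_le (hg.mono hAB)).trans_lt ((lintegral_mono_set hAB).trans_lt hgb)

lemma totalVar_of_isOpen {μ : Measure X} {v : X → ℝ} {A : Set X} (hA : IsOpen A) :
    totalVar μ v A = variationOn μ v A :=
  le_antisymm (iInf₂_le A ⟨hA, Subset.rfl⟩) (le_iInf₂ fun _ hB => variationOn_mono hB.2)

lemma gradEnergy_add_le {μ : Measure X} {u : X → ℝ} {A B C : Set X} (hA : A ⊆ C) (hB : B ⊆ C)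
    (hAB : Disjoint A B) (hBo : IsOpen B) :
    gradEnergy μ u A + gradEnergy μ u B ≤ gradEnergy μ u C := by
  refine le_of_forall_gt fun b hb => ?_
  obtain ⟨g, hg, hgb⟩ := exists_isUpperGradientOn hb
  refine lt_of_le_of_lt ?_ hgb
  calc _ ≤ ∫⁻ x in A, g x ∂μ + ∫⁻ x in B, g x ∂μ :=
        add_le_add (gradEnergy_le (hg.mono hA)) (gradEnergy_le (hg.mono hB))
    _ = ∫⁻ x in A ∪ B, g x ∂μ := (lintegral_union hBo.measurableSet hAB).symm
    _ ≤ _ := lintegral_mono_set (union_subset hA hB)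

lemma ENNReal.liminf_add_liminf_le (f g : ℕ → ℝ≥0∞) :
    liminf f atTop + liminf g atTop ≤ liminf (fun n => f n + g n) atTop := by
  simp only [liminf_eq_iSup_iInf_of_nat]
  rw [ENNReal.iSup_add_iSup_of_monotone]
  · exact iSup_mono fun n => le_iInf₂ fun i hi => add_le_add (iInf₂_le i hi) (iInf₂_le i hi)
  all_goals
    exact fun a b hab => le_iInf₂ fun i hi => iInf₂_le i (le_trans hab hi)

lemma variationOn_add_le {μ : Measure X} {v : X → ℝ} {A B C : Set X} (hA : A ⊆ C) (hB : B ⊆ C)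
    (hAB : Disjoint A B) (hBo : IsOpen B) :
    variationOn μ v A + variationOn μ v B ≤ variationOn μ v C := by
  refine le_iInf₂ fun u hu => ?_
  have key : ∀ D ⊆ C, variationOn μ v D ≤ liminf (fun i => gradEnergy μ (u i) D) atTop :=
    fun D hD => variationOn_le_liminf (fun i => (hu.1 i).mono hD) (hu.2.mono hD)
  exact (add_le_add (key A hA) (key B hB)).trans ((ENNReal.liminf_add_liminf_le _ _).trans
    (liminf_le_liminf (Eventually.of_forall fun i => gradEnergy_add_le hA hB hAB hBo)))

lemma variationOn_empty (μ : Measure X) (v : X → ℝ) : variationOn μ v ∅ = 0 := by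
  refine le_antisymm ?_ bot_le
  have hconst : TendstoL1loc μ ∅ (fun _ _ => 0) v := by
    intro W' _ _ h
    have : W' = ∅ := subset_empty_iff.1 (subset_closure.trans h)
    simp [this]
  refine (variationOn_le_liminf (fun i x hx => hx.elim) hconst).trans ?_
  have : gradEnergy μ (fun _ : X => (0:ℝ)) ∅ = 0 :=
    le_antisymm ((gradEnergy_le (g := fun _ => 0)
      ⟨measurable_const, fun γ _ => by simp [UpperGradIneq]⟩).trans (by simp)) bot_le
  simp [this]

section Approximation

variable [ProperSpace X]

/-- Extraction of one good approximant. -/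
lemma exists_approx_of_variationOn_lt {μ : Measure X} {v : X → ℝ} {A K : Set X}
    {b δ : ℝ≥0∞} (hA : IsOpen A) (hb : variationOn μ v A < b) (hK : IsCompact K) (hKA : K ⊆ A)
    (hδ : δ ≠ 0) :
    ∃ (u : X → ℝ) (g : X → ℝ≥0∞), LocLipschitzOn u A ∧ IsUpperGradientOn g u A ∧
      ∫⁻ x in A, g x ∂μ < b ∧ ∫⁻ x in K, ENNReal.ofReal |u x - v x| ∂μ < δ := by
  simp only [variationOn, iInf_lt_iff] at hb
  obtain ⟨u, ⟨hu, huv⟩, hlt⟩ := hb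
  obtain ⟨V, hV, hKV, hVA, hVc⟩ := exists_open_between_and_isCompact_closure hK hA hKA
  have h1 := frequently_lt_of_liminf_lt (by isBoundedDefault) hlt
  have h2 := (huv V hV hVc hVA).eventually_lt_const (pos_iff_ne_zero.2 hδ)
  obtain ⟨i, hi1, hi2⟩ := (h1.and_eventually h2).exists
  obtain ⟨g, hg, hgb⟩ := exists_isUpperGradientOn hi1
  exact ⟨u i, g, hu i, hg, hgb, (lintegral_mono_set hKV).trans_lt hi2⟩

/-- An exhaustion of an open set by relatively compact open sets. -/
lemma IsOpen.exists_exhaustion {Ω : Set X} (hΩ : IsOpen Ω) :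
    ∃ W : ℕ → Set X, (∀ n, IsOpen (W n)) ∧ (∀ n, IsCompact (closure (W n))) ∧
      (∀ n, closure (W n) ⊆ W (n + 1)) ∧ (∀ n, W n ⊆ Ω) ∧
      ∀ K, IsCompact K → K ⊆ Ω → ∃ n, K ⊆ W n := by
  have : LocallyCompactSpace Ω := hΩ.locallyCompactSpace
  let E : CompactExhaustion Ω := default
  have hcl : ∀ n, closure ((↑) '' interior (E n) : Set X) ⊆ (↑) '' (E n) := fun n =>
    closure_minimal (image_mono interior_subset)
      ((E.isCompact n).image continuous_subtype_val).isClosed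
  refine ⟨fun n => (↑) '' interior (E n), fun n => hΩ.isOpenMap_subtype_val _ isOpen_interior,
    fun n => ((E.isCompact n).image continuous_subtype_val).of_isClosed_subset isClosed_closure
      (hcl n), fun n => (hcl n).trans (image_mono (E.subset_interior_succ n)),
    fun n => by rintro _ ⟨x, -, rfl⟩; exact x.2, fun K hK hKΩ => ?_⟩
  have hK' : IsCompact ((↑) ⁻¹' K : Set Ω) :=
    Topology.IsInducing.subtypeVal.isCompact_preimage' hK (by simpa using hKΩ)
  obtain ⟨n, hn⟩ := E.exists_superset_of_isCompact hK'
  exact ⟨n + 1, fun x hx => ⟨⟨x, hKΩ hx⟩, E.subset_interior_succ n (hn hx), rfl⟩⟩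

lemma variationOn_le_of_approx {μ : Measure X} {v : X → ℝ} {Ω : Set X} {a : ℝ≥0∞}
    (hΩ : IsOpen Ω)
    (h : ∀ K, IsCompact K → K ⊆ Ω → ∀ ε : ℝ≥0∞, ε ≠ 0 → ∃ (w : X → ℝ) (g : X → ℝ≥0∞),
      LocLipschitzOn w Ω ∧ IsUpperGradientOn g w Ω ∧ ∫⁻ x in Ω, g x ∂μ ≤ a + ε ∧
      ∫⁻ x in K, ENNReal.ofReal |w x - v x| ∂μ ≤ ε) :
    variationOn μ v Ω ≤ a := by
  obtain ⟨W, -, hWc, hWs, hWΩ, hW⟩ := hΩ.exists_exhaustion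
  have hmono : Monotone W := monotone_nat_of_le_succ fun n => subset_closure.trans (hWs n)
  have hlim : Tendsto (fun n : ℕ => ((n : ℝ≥0∞))⁻¹) atTop (𝓝 0) :=
    ENNReal.tendsto_inv_nat_nhds_zero
  choose w g hw hg hga hwv using fun n : ℕ => h (closure (W n)) (hWc n)
    ((hWs n).trans (hWΩ _)) ((n : ℝ≥0∞))⁻¹ (by simp)
  have hconv : TendstoL1loc μ Ω w v := by
    intro W' _ hc hsub
    obtain ⟨m, hm⟩ := hW _ hc hsub
    refine tendsto_of_tendsto_of_tendsto_of_le_of_le' tendsto_const_nhds hlim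
      (Eventually.of_forall fun _ => bot_le) ?_
    filter_upwards [eventually_ge_atTop m] with n hn
    exact (lintegral_mono_set (subset_closure.trans (hm.trans
      ((hmono hn).trans subset_closure)))).trans (hwv n)
  refine (variationOn_le_liminf hw hconv).trans ((liminf_le_liminf (Eventually.of_forall fun n =>
    (gradEnergy_le (hg n)).trans (hga n))).trans ?_)
  have : Tendsto (fun n : ℕ => a + ((n : ℝ≥0∞))⁻¹) atTop (𝓝 (a + 0)) :=
    tendsto_const_nhds.add hlim
  rw [this.liminf_eq, add_zero]

lemma LocLipschitzOn.continuousOn {u : X → ℝ} {W : Set X} (h : LocLipschitzOn u W) :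
    ContinuousOn u W :=
  LocallyLipschitzOn.continuousOn fun x hx => h x hx

lemma LocLipschitzOn.add {u v : X → ℝ} {W : Set X} (hu : LocLipschitzOn u W)
    (hv : LocLipschitzOn v W) : LocLipschitzOn (fun x => u x + v x) W := by
  intro x hx
  exact LocallyLipschitzOn.add (fun x hx => hu x hx) (fun x hx => hv x hx) hx

lemma IsUpperGradientOn.add {g h : X → ℝ≥0∞} {u v : X → ℝ} {W : Set X}
    (hu : IsUpperGradientOn g u W) (hv : IsUpperGradientOn h v W) :
    IsUpperGradientOn (fun x => g x + h x) (fun x => u x + v x) W := by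
  refine ⟨hu.1.add hv.1, fun γ hγ => le_trans ?_ (curveLintegral_add_le g h γ)⟩
  refine le_trans ?_ (add_le_add (hu.2 γ hγ) (hv.2 γ hγ))
  rw [← ENNReal.ofReal_add (abs_nonneg _) (abs_nonneg _), add_sub_add_comm]
  exact ENNReal.ofReal_le_ofReal (abs_add_le _ _)

lemma variationOn_fun_add_le {μ : Measure X} {v₁ v₂ : X → ℝ} {A : Set X} (hA : IsOpen A)
    (hv₁ : Measurable v₁) :
    variationOn μ (fun x => v₁ x + v₂ x) A ≤ variationOn μ v₁ A + variationOn μ v₂ A := by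
  by_cases h1 : variationOn μ v₁ A = ⊤
  · simp [h1]
  by_cases h2 : variationOn μ v₂ A = ⊤
  · simp [h2]
  refine variationOn_le_of_approx hA fun K hK hKA ε hε => ?_
  have hε2 : ε / 2 ≠ 0 := (ENNReal.half_pos hε).ne'
  obtain ⟨u₁, g₁, hu₁, hg₁, he₁, hd₁⟩ :=
    exists_approx_of_variationOn_lt hA (ENNReal.lt_add_right h1 hε2) hK hKA hε2
  obtain ⟨u₂, g₂, hu₂, hg₂, he₂, hd₂⟩ :=
    exists_approx_of_variationOn_lt hA (ENNReal.lt_add_right h2 hε2) hK hKA hε2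
  refine ⟨_, _, hu₁.add hu₂, hg₁.add hg₂, ?_, ?_⟩
  · rw [lintegral_add_left hg₁.1]
    refine (add_le_add he₁.le he₂.le).trans_eq ?_
    rw [add_add_add_comm, ENNReal.add_halves]
  · have hm : AEMeasurable u₁ (μ.restrict K) :=
      (hu₁.continuousOn.mono hKA).aemeasurable hK.measurableSet
    calc _ ≤ ∫⁻ x in K, (ENNReal.ofReal |u₁ x - v₁ x| + ENNReal.ofReal |u₂ x - v₂ x|) ∂μ := by
          refine lintegral_mono fun x => ?_
          rw [← ENNReal.ofReal_add (abs_nonneg _) (abs_nonneg _), add_sub_add_comm]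
          exact ENNReal.ofReal_le_ofReal (abs_add_le _ _)
      _ = _ := lintegral_add_left' (by fun_prop) _
      _ ≤ ε / 2 + ε / 2 := add_le_add hd₁.le hd₂.le
      _ = ε := ENNReal.add_halves ε

/-- The restriction of a curve to the subinterval `[a, b]`. -/
def Curve.restrict (γ : Curve X) {a b : ℝ} (ha : 0 ≤ a) (hab : a ≤ b) (hb : b ≤ γ.len) :
    Curve X where
  len := b - a
  len_nonneg := sub_nonneg.2 hab
  toFun s := γ.toFun (a + s)
  lipschitzOn := by
    intro s hs t ht
    have := γ.lipschitzOn (x := a + s) ⟨by linarith [hs.1], by linarith [hs.2]⟩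
      (y := a + t) ⟨by linarith [ht.1], by linarith [ht.2]⟩
    simpa using this

lemma IsUpperGradientOn.le_lintegral_Ioc {g : X → ℝ≥0∞} {u : X → ℝ} {A : Set X}
    (h : IsUpperGradientOn g u A) (γ : Curve X) {a b : ℝ} (ha : 0 ≤ a) (hab : a ≤ b)
    (hb : b ≤ γ.len) (hγ : ∀ s ∈ Icc a b, γ.toFun s ∈ A) :
    ENNReal.ofReal |u (γ.toFun b) - u (γ.toFun a)| ≤ ∫⁻ s in Ioc a b, g (γ.toFun s) := by
  have h1 := h.2 (γ.restrict ha hab hb) fun s hs =>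
    hγ _ ⟨by linarith [hs.1], by have := hs.2; simp only [Curve.restrict] at this; linarith⟩
  simp only [UpperGradIneq, curveLintegral, Curve.restrict, add_zero, add_sub_cancel] at h1
  rw [abs_sub_comm, setLIntegral_congr Ioc_ae_eq_Icc]
  refine h1.trans_eq ?_
  have := (measurePreserving_add_left volume a).setLIntegral_comp_preimage_emb
    (measurableEmbedding_addLeft a) (fun s => g (γ.toFun s)) (Icc a b)
  simpa using this

lemma ofReal_abs_sub_le_lintegral_of_cover {f : ℝ → ℝ} {H : ℝ → ℝ≥0∞} {L : ℝ} (hL : 0 ≤ L)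
    {ι : Type*} {c : ι → Set (Icc (0:ℝ) L)} (hc : ∀ i, IsOpen (c i)) (hcov : univ ⊆ ⋃ i, c i)
    (hloc : ∀ i, ∀ a b : Icc (0:ℝ) L, a ≤ b → Icc a b ⊆ c i →
      ENNReal.ofReal |f b - f a| ≤ ∫⁻ s in Ioc (a:ℝ) b, H s) :
    ENNReal.ofReal |f L - f 0| ≤ ∫⁻ s in Ioc 0 L, H s := by
  obtain ⟨t, ht0, htm, ⟨m, hm⟩, hti⟩ := exists_monotone_Icc_subset_open_cover_Icc hL hc hcov
  have key : ∀ n, ENNReal.ofReal |f (t n) - f 0| ≤ ∫⁻ s in Ioc 0 (t n : ℝ), H s := by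
    intro n
    induction n with
    | zero => simp [ht0]
    | succ n ih =>
      obtain ⟨i, hi⟩ := hti n
      have hle : (t n : ℝ) ≤ t (n + 1) := htm n.le_succ
      rw [← Ioc_union_Ioc_eq_Ioc (t n).2.1 hle, lintegral_union measurableSet_Ioc
        (Ioc_disjoint_Ioc_of_le le_rfl)]
      refine le_trans ?_ (add_le_add ih (hloc i _ _ (htm n.le_succ) hi))
      rw [← ENNReal.ofReal_add (abs_nonneg _) (abs_nonneg _)]
      refine ENNReal.ofReal_le_ofReal ?_
      exact (abs_sub_le _ (f (t n)) _).trans_eq (add_comm _ _)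
  simpa [hm m le_rfl] using key m

lemma measurable_indicator_ofReal_abs_sub {u v : X → ℝ} {K : Set X} (hu : ContinuousOn u K)
    (hK : IsOpen K) (hv : Measurable v) :
    Measurable (K.indicator fun y => ENNReal.ofReal |u y - v y|) := by
  classical
  have h1 : Measurable (K.piecewise u fun _ => 0) :=
    hu.measurable_piecewise continuousOn_const hK.measurableSet
  have h2 : K.indicator (fun y => ENNReal.ofReal |u y - v y|) = K.indicator
      fun y => ENNReal.ofReal |K.piecewise u (fun _ => 0) y - v y| := by
    refine indicator_congr fun y hy => ?_
    rw [piecewise_eq_of_mem _ _ _ hy]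
  rw [h2]
  refine Measurable.indicator ?_ hK.measurableSet
  fun_prop

/-- A locally finite partition of unity on `Ω` by Lipschitz functions, the support of `φ k`
lying in `A k`. -/
structure LipschitzPartition (Ω : Set X) (A : ℕ → Set X) (φ : ℕ → X → ℝ) : Prop where
  nonneg : ∀ k x, 0 ≤ φ k x
  le_one : ∀ k x, φ k x ≤ 1
  lipschitz : ∀ k, ∃ L : ℝ≥0, LipschitzWith L (φ k)
  tsupport_subset : ∀ k, tsupport (φ k) ⊆ A k
  isCompact : ∀ k, IsCompact (tsupport (φ k))
  locallyFinite : ∀ x ∈ Ω, ∃ N, ∀ᶠ y in 𝓝 x, ∀ k ≥ N, φ k y = 0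
  tsum_eq_one : ∀ x ∈ Ω, ∑' k, φ k x = 1

namespace LipschitzPartition

variable {Ω : Set X} {A : ℕ → Set X} {φ : ℕ → X → ℝ}

lemma exists_finset (h : LipschitzPartition Ω A φ) {x : X} (hx : x ∈ Ω) :
    ∃ S : Finset ℕ, (∀ k ∈ S, x ∈ tsupport (φ k)) ∧ ∀ᶠ y in 𝓝 x, ∀ k ∉ S, φ k y = 0 := by
  classical
  obtain ⟨N, hN⟩ := h.locallyFinite x hx
  refine ⟨(Finset.range N).filter fun k => x ∈ tsupport (φ k), by simp, ?_⟩
  have : ∀ᶠ y in 𝓝 x, ∀ k ∈ Finset.range N, x ∉ tsupport (φ k) → φ k y = 0 := by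
    rw [Filter.eventually_all_finset]
    intro k _
    by_cases hk : x ∈ tsupport (φ k)
    · simp [hk]
    · filter_upwards [(isClosed_tsupport (φ k)).isOpen_compl.mem_nhds hk] with y hy _
      exact image_eq_zero_of_notMem_tsupport hy
  filter_upwards [hN, this] with y h1 h2 k hk
  by_cases hkN : k < N
  · exact h2 k (by simpa using hkN) (by simpa [hkN] using hk)
  · exact h1 k (not_lt.1 hkN)

lemma locLipschitzOn (h : LipschitzPartition Ω A φ) (hΩ : IsOpen Ω) (hA : ∀ k, IsOpen (A k))
    {u : ℕ → X → ℝ} (hu : ∀ k, LocLipschitzOn (u k) (A k)) :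
    LocLipschitzOn (fun x => ∑' k, φ k x * u k x) Ω := by
  classical
  intro x hx
  rw [hΩ.nhdsWithin_eq hx]
  obtain ⟨S, hS, hev⟩ := h.exists_finset hx
  have hprod : ∀ k ∈ S, ∃ K : ℝ≥0, ∃ t ∈ 𝓝 x, LipschitzOnWith K (fun y => φ k y * u k y) t := by
    intro k hk
    have hxA := h.tsupport_subset k (hS k hk)
    obtain ⟨K, t, ht, hK⟩ := hu k x hxA
    rw [(hA k).nhdsWithin_eq hxA] at ht
    obtain ⟨L, hL⟩ := h.lipschitz k
    have hcont : ContinuousAt (u k) x := (hu k).continuousOn.continuousAt ((hA k).mem_nhds hxA)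
    have hbd : ∀ᶠ y in 𝓝 x, |u k y| < |u k x| + 1 :=
      hcont.abs.eventually_lt_const (by linarith)
    let M : ℝ≥0 := ⟨|u k x| + 1, by positivity⟩
    refine ⟨K + M * L, _, inter_mem ht hbd, LipschitzOnWith.of_dist_le_mul fun y hy z hz => ?_⟩
    have h1 := hK.dist_le_mul y hy.1 z hz.1
    have h2 := hL.dist_le_mul y z
    simp only [Real.dist_eq, NNReal.coe_add, NNReal.coe_mul] at h1 h2 ⊢
    have h3 : |u k z| ≤ M := le_of_lt hz.2
    calc |φ k y * u k y - φ k z * u k z|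
        = |φ k y * (u k y - u k z) + u k z * (φ k y - φ k z)| := by ring_nf
      _ ≤ |φ k y| * |u k y - u k z| + |u k z| * |φ k y - φ k z| := by
        rw [← abs_mul, ← abs_mul]; exact abs_add_le _ _
      _ ≤ 1 * (K * dist y z) + M * (L * dist y z) := by
        have : |φ k y| ≤ 1 := by rw [abs_of_nonneg (h.nonneg k y)]; exact h.le_one k y
        gcongr
      _ = _ := by ring
  have hsum : ∀ T ⊆ S, ∃ K : ℝ≥0, ∃ t ∈ 𝓝 x,
      LipschitzOnWith K (fun y => ∑ k ∈ T, φ k y * u k y) t := by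
    intro T
    induction T using Finset.induction_on with
    | empty => exact fun _ => ⟨0, univ, univ_mem, by simp⟩
    | insert k T hk ih =>
      intro hT
      obtain ⟨K₁, t₁, ht₁, h₁⟩ := ih ((Finset.subset_insert _ _).trans hT)
      obtain ⟨K₂, t₂, ht₂, h₂⟩ := hprod k (hT (Finset.mem_insert_self _ _))
      refine ⟨K₂ + K₁, t₂ ∩ t₁, inter_mem ht₂ ht₁, ?_⟩
      simp only [Finset.sum_insert hk]
      exact (h₂.mono inter_subset_left).add (h₁.mono inter_subset_right)
  obtain ⟨K, t, ht, hK⟩ := hsum S Subset.rfl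
  refine ⟨K, _, inter_mem ht hev, fun y hy z hz => ?_⟩
  have e : ∀ y ∈ {y | ∀ k ∉ S, φ k y = 0}, ∑' k, φ k y * u k y = ∑ k ∈ S, φ k y * u k y :=
    fun y hy => tsum_eq_sum fun k hk => by rw [hy k hk, zero_mul]
  simp only [e y hy.2, e z hz.2]
  exact hK hy.1 hz.1

/-- The local form of the Leibniz rule along a curve. -/
lemma exists_local_estimate (h : LipschitzPartition Ω A φ) {K : ℕ → Set X} {u : ℕ → X → ℝ}
    {g : ℕ → X → ℝ≥0∞} {L : ℕ → ℝ≥0} (v : X → ℝ) (hA : ∀ k, IsOpen (A k))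
    (hL : ∀ k, LipschitzWith (L k) (φ k)) (hK : ∀ k, IsOpen (K k))
    (hφK : ∀ k, tsupport (φ k) ⊆ K k) (hKA : ∀ k, K k ⊆ A k)
    (hu : ∀ k, ContinuousOn (u k) (A k)) (hg : ∀ k, IsUpperGradientOn (g k) (u k) (A k))
    {x : X} (hx : x ∈ Ω) {ε : ℝ} (hε : 0 < ε) :
    ∃ U, IsOpen U ∧ x ∈ U ∧ ∀ γ : Curve X, γ.IsIn Ω → ∀ a b, 0 ≤ a → a ≤ b → b ≤ γ.len →
      (∀ s ∈ Icc a b, γ.toFun s ∈ U) →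
      ENNReal.ofReal |∑' k, φ k (γ.toFun b) * u k (γ.toFun b) -
          ∑' k, φ k (γ.toFun a) * u k (γ.toFun a)| ≤
        ∫⁻ s in Ioc a b, (∑' k, ((A k).indicator (g k) (γ.toFun s) +
          L k * (K k).indicator (fun y => ENNReal.ofReal |u k y - v y|) (γ.toFun s)) +
          ENNReal.ofReal ε) := by
  classical
  obtain ⟨S, hS, hev⟩ := h.exists_finset hx
  set η : ℝ := ε / (2 * (∑ k ∈ S, (L k : ℝ)) + 1) with hη
  have hden : 0 < 2 * (∑ k ∈ S, (L k : ℝ)) + 1 := by positivity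
  have hη0 : 0 < η := div_pos hε hden
  have hηε : ∑ k ∈ S, (L k : ℝ) * (2 * η) ≤ ε := by
    rw [← Finset.sum_mul, hη, ← mul_assoc, ← mul_div_assoc, div_le_iff₀ hden]
    nlinarith
  have hev2 : ∀ᶠ y in 𝓝 x, ∀ k ∈ S, y ∈ K k ∧ |u k y - u k x| < η := by
    rw [Filter.eventually_all_finset]
    intro k hk
    have hxK := hφK k (hS k hk)
    have hcont : ContinuousAt (u k) x := (hu k).continuousAt ((hA k).mem_nhds (hKA k hxK))
    filter_upwards [(hK k).mem_nhds hxK, Metric.tendsto_nhds.1 hcont η hη0] with y h1 h2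
    exact ⟨h1, h2⟩
  obtain ⟨U, hU, hUo, hxU⟩ := _root_.eventually_nhds_iff.1 (hev.and hev2)
  refine ⟨U, hUo, hxU, fun γ hγ a b ha hab hb hγU => ?_⟩
  rcases hab.eq_or_lt with rfl | hlt
  · simp
  have haI : a ∈ Icc a b := left_mem_Icc.2 hab
  have hbI : b ∈ Icc a b := right_mem_Icc.2 hab
  have e : ∀ s ∈ Icc a b, ∀ c : ℕ → ℝ,
      ∑' k, φ k (γ.toFun s) * c k = ∑ k ∈ S, φ k (γ.toFun s) * c k := fun s hs c =>
    tsum_eq_sum fun k hk => by rw [(hU _ (hγU s hs)).1 k hk, zero_mul]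
  have e1 : ∀ s ∈ Icc a b, ∑ k ∈ S, φ k (γ.toFun s) = 1 := fun s hs => by
    have := e s hs fun _ => 1
    simp only [mul_one] at this
    rw [← this, h.tsum_eq_one _ (hγ s ⟨ha.trans hs.1, hs.2.trans hb⟩)]
  have hI : ∀ k ∈ S, ENNReal.ofReal |u k (γ.toFun b) - u k (γ.toFun a)| ≤
      ∫⁻ s in Ioc a b, (A k).indicator (g k) (γ.toFun s) := by
    intro k hk
    have hin : ∀ s ∈ Icc a b, γ.toFun s ∈ A k := fun s hs => hKA k ((hU _ (hγU s hs)).2 k hk).1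
    refine ((hg k).le_lintegral_Ioc γ ha hab hb hin).trans (setLIntegral_mono' measurableSet_Ioc
      fun s hs => ?_)
    rw [indicator_of_mem (hin s (Ioc_subset_Icc_self hs))]
  rw [e a haI, e b hbI]
  set X₀ := ENNReal.ofReal |∑ k ∈ S, φ k (γ.toFun b) * u k (γ.toFun b) -
    ∑ k ∈ S, φ k (γ.toFun a) * u k (γ.toFun a)| with hX₀
  set B : ℝ → ℝ≥0∞ := fun r => ∑ k ∈ S, L k * (K k).indicator
    (fun y => ENNReal.ofReal |u k y - v y|) (γ.toFun r) + ENNReal.ofReal ε with hB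
  set I := ∑ k ∈ S, ENNReal.ofReal |u k (γ.toFun b) - u k (γ.toFun a)| with hI'
  have hpt : ∀ r ∈ Ioc a b, X₀ ≤ I + ENNReal.ofReal (b - a) * B r := by
    intro r hr
    have hrI := Ioc_subset_Icc_self hr
    set c := v (γ.toFun r) with hc
    have hid : ∑ k ∈ S, φ k (γ.toFun b) * u k (γ.toFun b) -
        ∑ k ∈ S, φ k (γ.toFun a) * u k (γ.toFun a) =
        ∑ k ∈ S, φ k (γ.toFun b) * (u k (γ.toFun b) - u k (γ.toFun a)) +
        ∑ k ∈ S, (φ k (γ.toFun b) - φ k (γ.toFun a)) * (u k (γ.toFun a) - c) := by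
      have h2 : ∑ k ∈ S, (φ k (γ.toFun b) - φ k (γ.toFun a)) * c = 0 := by
        rw [← Finset.sum_mul, Finset.sum_sub_distrib, e1 a haI, e1 b hbI]; simp
      rw [← add_zero (_ + _), ← h2, ← Finset.sum_sub_distrib, ← Finset.sum_add_distrib,
        ← Finset.sum_add_distrib]
      exact Finset.sum_congr rfl fun k _ => by ring
    have hdist : dist (γ.toFun b) (γ.toFun a) ≤ b - a := by
      have := γ.lipschitzOn.dist_le_mul b ⟨ha.trans hab, hb⟩ a ⟨ha, hab.trans hb⟩
      rwa [NNReal.coe_one, one_mul, Real.dist_eq, abs_of_nonneg (sub_nonneg.2 hab)] at this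
    have hreal : |∑ k ∈ S, φ k (γ.toFun b) * u k (γ.toFun b) -
        ∑ k ∈ S, φ k (γ.toFun a) * u k (γ.toFun a)| ≤
        ∑ k ∈ S, |u k (γ.toFun b) - u k (γ.toFun a)| +
        (b - a) * (∑ k ∈ S, L k * |u k (γ.toFun r) - c| + ε) := by
      rw [hid]
      refine (abs_add_le _ _).trans (add_le_add ((Finset.abs_sum_le_sum_abs _ _).trans
        (Finset.sum_le_sum fun k _ => ?_)) ((Finset.abs_sum_le_sum_abs _ _).trans ?_))
      · rw [abs_mul, abs_of_nonneg (h.nonneg k _)]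
        exact mul_le_of_le_one_left (abs_nonneg _) (h.le_one k _)
      · calc _ ≤ ∑ k ∈ S, (b - a) * (L k * |u k (γ.toFun r) - c| + L k * (2 * η)) := by
              refine Finset.sum_le_sum fun k hk => ?_
              have h1 := (hL k).dist_le_mul (γ.toFun b) (γ.toFun a)
              rw [Real.dist_eq] at h1
              have h2 : |u k (γ.toFun a) - c| ≤ |u k (γ.toFun r) - c| + 2 * η := by
                have h3 := abs_lt.1 ((hU _ (hγU a haI)).2 k hk).2
                have h4 := abs_lt.1 ((hU _ (hγU r hrI)).2 k hk).2
                have h5 : |u k (γ.toFun a) - u k (γ.toFun r)| ≤ 2 * η :=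
                  abs_le.2 ⟨by linarith, by linarith⟩
                linarith [abs_sub_le (u k (γ.toFun a)) (u k (γ.toFun r)) c]
              rw [abs_mul]
              calc _ ≤ (L k * (b - a)) * (|u k (γ.toFun r) - c| + 2 * η) := by
                    gcongr
                    exact h1.trans (by gcongr)
                _ = _ := by ring
          _ = (b - a) * (∑ k ∈ S, L k * |u k (γ.toFun r) - c| + ∑ k ∈ S, L k * (2 * η)) := by
              rw [← Finset.mul_sum, Finset.sum_add_distrib]
          _ ≤ _ := by
              have := sub_nonneg.2 hab
              gcongr
    refine (ENNReal.ofReal_le_ofReal hreal).trans_eq ?_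
    rw [ENNReal.ofReal_add (by positivity) (mul_nonneg (sub_nonneg.2 hab) (by positivity)),
      ENNReal.ofReal_mul (sub_nonneg.2 hab), ENNReal.ofReal_add (by positivity) hε.le,
      ENNReal.ofReal_sum_of_nonneg fun _ _ => abs_nonneg _,
      ENNReal.ofReal_sum_of_nonneg fun _ _ => by positivity, hI', hB]
    congr 3
    refine Finset.sum_congr rfl fun k hk => ?_
    rw [ENNReal.ofReal_mul (by positivity), ENNReal.ofReal_coe_nnreal,
      indicator_of_mem ((hU _ (hγU r hrI)).2 k hk).1]
  have hvol : volume (Ioc a b) = ENNReal.ofReal (b - a) := Real.volume_Ioc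
  have hpos : ENNReal.ofReal (b - a) ≠ 0 := by simpa using hlt
  have hX : X₀ ≤ I + ∫⁻ r in Ioc a b, B r := by
    have h1 : ENNReal.ofReal (b - a) * X₀ ≤ ENNReal.ofReal (b - a) * (I + ∫⁻ r in Ioc a b, B r) := by
      calc _ = ∫⁻ _ in Ioc a b, X₀ := by
            rw [setLIntegral_const, hvol, mul_comm]
        _ ≤ ∫⁻ r in Ioc a b, (I + ENNReal.ofReal (b - a) * B r) :=
            setLIntegral_mono' measurableSet_Ioc hpt
        _ = _ := by
            rw [lintegral_add_left measurable_const, lintegral_const_mul' _ _ ENNReal.ofReal_ne_top,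
              setLIntegral_const, hvol]
            ring
    exact (ENNReal.mul_le_mul_iff_right hpos ENNReal.ofReal_ne_top).1 h1
  calc X₀ ≤ (∑ k ∈ S, ∫⁻ s in Ioc a b, (A k).indicator (g k) (γ.toFun s)) +
        ∫⁻ r in Ioc a b, B r :=
        hX.trans (add_le_add (Finset.sum_le_sum hI) le_rfl)
    _ ≤ (∫⁻ s in Ioc a b, ∑ k ∈ S, (A k).indicator (g k) (γ.toFun s)) + ∫⁻ r in Ioc a b, B r :=
        add_le_add (sum_lintegral_le _ _ _) le_rfl
    _ ≤ _ := (le_lintegral_add _ _).trans (lintegral_mono fun s => ?_)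
  simp only [hB]
  rw [← add_assoc, ← Finset.sum_add_distrib]
  exact add_le_add (ENNReal.sum_le_tsum _) le_rfl

lemma isUpperGradientOn (h : LipschitzPartition Ω A φ) {K : ℕ → Set X} {u : ℕ → X → ℝ}
    {g : ℕ → X → ℝ≥0∞} {L : ℕ → ℝ≥0} {v : X → ℝ} (hA : ∀ k, IsOpen (A k))
    (hL : ∀ k, LipschitzWith (L k) (φ k)) (hK : ∀ k, IsOpen (K k))
    (hφK : ∀ k, tsupport (φ k) ⊆ K k) (hKA : ∀ k, K k ⊆ A k)
    (hu : ∀ k, ContinuousOn (u k) (A k)) (hg : ∀ k, IsUpperGradientOn (g k) (u k) (A k))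
    (hv : Measurable v) :
    IsUpperGradientOn (fun x => ∑' k, ((A k).indicator (g k) x +
        L k * (K k).indicator (fun y => ENNReal.ofReal |u k y - v y|) x))
      (fun x => ∑' k, φ k x * u k x) Ω := by
  refine ⟨Measurable.tsum fun k => ((hg k).1.indicator (hA k).measurableSet).add
    (measurable_const.mul ?_), fun γ hγ => ?_⟩
  · exact measurable_indicator_ofReal_abs_sub ((hu k).mono (hKA k)) (hK k) hv
  · refine ENNReal.le_of_forall_pos_le_add fun δ hδ _ => ?_
    have hL1 : 0 < γ.len + 1 := by linarith [γ.len_nonneg]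
    set ε : ℝ := δ / (γ.len + 1) with hε
    have hε0 : 0 < ε := div_pos hδ hL1
    have hloc := fun s : Icc (0:ℝ) γ.len =>
      h.exists_local_estimate v hA hL hK hφK hKA hu hg (hγ s s.2) hε0
    choose U hUo hxU hU using hloc
    have hcont : Continuous fun s : Icc (0:ℝ) γ.len => γ.toFun s :=
      continuousOn_iff_continuous_domRestrict.1 γ.lipschitzOn.continuousOn
    have key := ofReal_abs_sub_le_lintegral_of_cover (f := fun s => ∑' k, φ k (γ.toFun s) *
      u k (γ.toFun s)) γ.len_nonneg (fun s => (hUo s).preimage hcont)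
      (fun s _ => mem_iUnion.2 ⟨s, hxU s⟩) fun i a b hab hsub =>
        hU i γ hγ a b a.2.1 hab b.2.2 fun s hs => hsub (show (⟨s, a.2.1.trans hs.1,
          hs.2.trans b.2.2⟩ : Icc (0:ℝ) γ.len) ∈ Icc a b from ⟨hs.1, hs.2⟩)
    rw [abs_sub_comm]
    refine key.trans ?_
    rw [lintegral_add_right _ measurable_const, curveLintegral,
      ← setLIntegral_congr Ioc_ae_eq_Icc,
      setLIntegral_const, Real.volume_Ioc, sub_zero, ← ENNReal.ofReal_mul hε0.le]
    refine add_le_add le_rfl ?_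
    rw [← ENNReal.ofReal_coe_nnreal]
    refine ENNReal.ofReal_le_ofReal ?_
    rw [hε, div_mul_eq_mul_div, div_le_iff₀ hL1]
    nlinarith [δ.2, hδ]

end LipschitzPartition

lemma LipschitzPartition.variationOn_le {μ : Measure X} {v : X → ℝ} {Ω : Set X}
    {A : ℕ → Set X} {φ : ℕ → X → ℝ} (h : LipschitzPartition Ω A φ) (hΩ : IsOpen Ω)
    (hA : ∀ k, IsOpen (A k)) (hv : Measurable v) :
    variationOn μ v Ω ≤ ∑' k, variationOn μ v (A k) := by
  by_cases htop : ∑' k, variationOn μ v (A k) = ⊤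
  · simp [htop]
  have hfin := ENNReal.ne_top_of_tsum_ne_top htop
  refine variationOn_le_of_approx hΩ fun C hC hCΩ ε hε => ?_
  obtain ⟨δ, hδ, hδε⟩ := ENNReal.exists_pos_sum_of_countable' (ENNReal.half_pos hε).ne' ℕ
  choose L hL using h.lipschitz
  choose K hK hφK hKA hKc using fun k =>
    exists_open_between_and_isCompact_closure (h.isCompact k) (hA k) (h.tsupport_subset k)
  have hKA' : ∀ k, K k ⊆ A k := fun k => subset_closure.trans (hKA k)
  choose u g hu hg hgV huv using fun k =>
    exists_approx_of_variationOn_lt (μ := μ) (v := v) (b := variationOn μ v (A k) + δ k)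
      (δ := δ k / (L k + 1)) (hA k)
      (ENNReal.lt_add_right (hfin k) (hδ k).ne') (hKc k) (hKA k)
      (ENNReal.div_pos (hδ k).ne' (by finiteness)).ne'
  have huc : ∀ k, ContinuousOn (u k) (A k) := fun k => (hu k).continuousOn
  have hmeas : ∀ k, Measurable ((K k).indicator fun y => ENNReal.ofReal |u k y - v y|) :=
    fun k => measurable_indicator_ofReal_abs_sub ((huc k).mono (hKA' k)) (hK k) hv
  have hint : ∀ k, ∀ D : Set X, ∫⁻ x in D, (K k).indicator
      (fun y => ENNReal.ofReal |u k y - v y|) x ∂μ ≤ δ k / (L k + 1) := fun k D => by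
    refine (setLIntegral_le_lintegral _ _).trans ?_
    rw [lintegral_indicator (hK k).measurableSet]
    exact (lintegral_mono_set subset_closure).trans (huv k).le
  refine ⟨_, _, h.locLipschitzOn hΩ hA hu,
    h.isUpperGradientOn hA hL hK hφK hKA' huc hg hv, ?_, ?_⟩
  · have hm : ∀ k, Measurable fun x => (A k).indicator (g k) x + (L k : ℝ≥0∞) *
        (K k).indicator (fun y => ENNReal.ofReal |u k y - v y|) x := fun k =>
      ((hg k).1.indicator (hA k).measurableSet).add (measurable_const.mul (hmeas k))
    rw [lintegral_tsum fun k => (hm k).aemeasurable]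
    calc _ ≤ ∑' k, (variationOn μ v (A k) + δ k + δ k) := by
          refine ENNReal.tsum_le_tsum fun k => ?_
          rw [lintegral_add_left ((hg k).1.indicator (hA k).measurableSet),
            lintegral_const_mul _ (hmeas k)]
          refine add_le_add ?_ ?_
          · refine (setLIntegral_le_lintegral _ _).trans ?_
            rw [lintegral_indicator (hA k).measurableSet]
            exact (hgV k).le
          · calc _ ≤ (L k + 1 : ℝ≥0∞) * (δ k / (L k + 1)) :=
                  mul_le_mul' le_self_add (hint k Ω)
              _ ≤ δ k := ENNReal.mul_div_le
      _ = ∑' k, variationOn μ v (A k) + (∑' k, δ k + ∑' k, δ k) := by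
          rw [ENNReal.tsum_add, ENNReal.tsum_add, add_assoc]
      _ ≤ _ := by
          rw [← ENNReal.add_halves ε]
          gcongr
  · have hpt : ∀ x ∈ C, ENNReal.ofReal |∑' k, φ k x * u k x - v x| ≤
        ∑' k, (K k).indicator (fun y => ENNReal.ofReal |u k y - v y|) x := by
      intro x hx
      obtain ⟨S, hS, hev⟩ := h.exists_finset (hCΩ hx)
      have h0 := hev.self_of_nhds
      have h1 : ∑ k ∈ S, φ k x = 1 := by
        rw [← h.tsum_eq_one x (hCΩ hx), tsum_eq_sum fun k hk => h0 k hk]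
      have h2 : ∑' k, φ k x * u k x - v x = ∑ k ∈ S, φ k x * (u k x - v x) := by
        rw [tsum_eq_sum (s := S) fun k hk => by rw [h0 k hk, zero_mul]]
        simp only [mul_sub, Finset.sum_sub_distrib, ← Finset.sum_mul, h1, one_mul]
      rw [h2]
      calc _ ≤ ENNReal.ofReal (∑ k ∈ S, |u k x - v x|) := by
            refine ENNReal.ofReal_le_ofReal ((Finset.abs_sum_le_sum_abs _ _).trans
              (Finset.sum_le_sum fun k _ => ?_))
            rw [abs_mul, abs_of_nonneg (h.nonneg k _)]
            exact mul_le_of_le_one_left (abs_nonneg _) (h.le_one k _)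
        _ = ∑ k ∈ S, (K k).indicator (fun y => ENNReal.ofReal |u k y - v y|) x := by
            rw [ENNReal.ofReal_sum_of_nonneg fun _ _ => abs_nonneg _]
            refine Finset.sum_congr rfl fun k hk => ?_
            rw [indicator_of_mem (hφK k (hS k hk))]
        _ ≤ _ := ENNReal.sum_le_tsum _
    calc _ ≤ ∫⁻ x in C, ∑' k, (K k).indicator (fun y => ENNReal.ofReal |u k y - v y|) x ∂μ :=
          setLIntegral_mono' hC.measurableSet hpt
      _ = ∑' k, ∫⁻ x in C, (K k).indicator (fun y => ENNReal.ofReal |u k y - v y|) x ∂μ :=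
          lintegral_tsum fun k => (hmeas k).aemeasurable
      _ ≤ ∑' k, δ k := ENNReal.tsum_le_tsum fun k => (hint k C).trans
          (ENNReal.div_le_of_le_mul (le_mul_of_one_le_right bot_le le_add_self))
      _ ≤ ε := hδε.le.trans ENNReal.half_le_self

lemma IsCompact.exists_lipschitz_cutoff {K U : Set X} (hK : IsCompact K) (hU : IsOpen U)
    (hKU : K ⊆ U) :
    ∃ χ : X → ℝ, (∃ L : ℝ≥0, LipschitzWith L χ) ∧ (∀ x, 0 ≤ χ x) ∧ (∀ x, χ x ≤ 1) ∧
      (∀ x ∈ K, χ x = 1) ∧ tsupport χ ⊆ U ∧ IsCompact (tsupport χ) := by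
  obtain ⟨δ, hδ, hδU⟩ := hK.exists_cthickening_subset_open hU hKU
  have hsub : tsupport (fun x => (thickenedIndicator hδ K x : ℝ)) ⊆ cthickening δ K := by
    refine closure_minimal (fun x hx => ?_) isClosed_cthickening
    by_contra hne
    exact hx (by simp [thickenedIndicator_zero hδ K
      fun h => hne (thickening_subset_cthickening _ _ h)])
  refine ⟨fun x => thickenedIndicator hδ K x, ⟨δ.toNNReal⁻¹, fun x y => ?_⟩, fun x => NNReal.coe_nonneg _,
    fun x => ?_, fun x hx => ?_, hsub.trans hδU,
    hK.cthickening.of_isClosed_subset (isClosed_tsupport _) hsub⟩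
  · exact lipschitzWith_thickenedIndicator hδ K x y
  · exact_mod_cast thickenedIndicator_le_one hδ K x
  · simp [thickenedIndicator_one hδ K hx]

lemma exists_lipschitzPartition_shells {Ω : Set X} {W : ℕ → Set X} (hWo : ∀ n, IsOpen (W n))
    (hWc : ∀ n, IsCompact (closure (W n))) (hWs : ∀ n, closure (W n) ⊆ W (n + 1))
    (hW : ∀ x ∈ Ω, ∃ n, x ∈ W n) (i : ℕ) :
    ∃ φ, LipschitzPartition Ω (fun k => Nat.casesOn k (W (i + 2))
      fun k => W (i + k + 3) \ closure (W (i + k))) φ := by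
  have hmono : Monotone W := monotone_nat_of_le_succ fun n => subset_closure.trans (hWs n)
  choose χ hχL hχ0 hχ1 hχK hχs hχc using fun n =>
    (hWc n).exists_lipschitz_cutoff (hWo (n + 1)) (hWs n)
  have hχW : ∀ n m x, m ≤ n → x ∈ W m → χ n x = 1 := fun n m x hmn hx =>
    hχK n x (subset_closure (hmono hmn hx))
  have hχmono : ∀ n x, χ n x ≤ χ (n + 1) x := by
    intro n x
    by_cases hx : x ∈ W (n + 1)
    · rw [hχW (n + 1) (n + 1) x le_rfl hx]; exact hχ1 n x
    · rw [image_eq_zero_of_notMem_tsupport fun h => hx (hχs n h)]; exact hχ0 _ x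
  let φ : ℕ → X → ℝ := fun k => Nat.casesOn k (χ (i + 1))
    fun k x => χ (i + k + 2) x - χ (i + k + 1) x
  have hzero : ∀ k, ∀ x ∈ W (i + k + 1), φ (k + 1) x = 0 := fun k x hx => by
    simp only [φ, hχW _ _ x le_rfl hx, hχW (i + k + 2) _ x (Nat.le_succ _) hx, sub_self]
  have hsupp : ∀ k, tsupport (φ (k + 1)) ⊆ tsupport (χ (i + k + 2)) := by
    intro k
    refine closure_mono fun x hx => ?_
    by_contra hne
    have h2 : χ (i + k + 2) x = 0 := by simpa using hne
    have h1 : χ (i + k + 1) x = 0 := le_antisymm (h2 ▸ hχmono (i + k + 1) x) (hχ0 _ x)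
    exact hx (by simp only [φ, h1, h2, sub_self])
  have hsum : ∀ n x, ∑ k ∈ Finset.range (n + 1), φ k x = χ (i + n + 1) x := by
    intro n x
    induction n with
    | zero => simp [φ]
    | succ n ih =>
      rw [Finset.sum_range_succ, ih]
      simp only [φ]
      rw [← add_assoc i n 1]
      ring
  have hzero' : ∀ m, ∀ x ∈ W m, ∀ k ≥ m + 1, φ k x = 0 := by
    intro m x hx k hk
    obtain ⟨j, rfl⟩ : ∃ j, k = j + 1 := ⟨k - 1, by omega⟩
    exact hzero j x (hmono (by omega) hx)
  refine ⟨φ, ?_, ?_, ?_, ?_, ?_, ?_, ?_⟩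
  · rintro (_ | k) x
    · exact hχ0 _ x
    · exact sub_nonneg.2 (hχmono _ x)
  · rintro (_ | k) x
    · exact hχ1 _ x
    · exact (sub_le_self _ (hχ0 _ x)).trans (hχ1 _ x)
  · rintro (_ | k)
    · exact hχL _
    · obtain ⟨L₁, h₁⟩ := hχL (i + k + 2)
      obtain ⟨L₂, h₂⟩ := hχL (i + k + 1)
      exact ⟨_, h₁.sub h₂⟩
  · rintro (_ | k)
    · exact hχs _
    · refine fun x hx => ⟨hχs _ (hsupp k hx), fun hcl => ?_⟩
      have hxW : x ∈ W (i + k + 1) := hWs _ hcl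
      have : x ∉ tsupport (φ (k + 1)) := by
        rw [notMem_tsupport_iff_eventuallyEq]
        filter_upwards [(hWo _).mem_nhds hxW] with y hy using hzero k y hy
      exact this hx
  · rintro (_ | k)
    · exact hχc _
    · exact (hχc _).of_isClosed_subset (isClosed_tsupport _) (hsupp k)
  · intro x hx
    obtain ⟨m, hm⟩ := hW x hx
    refine ⟨m + 1, ?_⟩
    filter_upwards [(hWo m).mem_nhds hm] with y hy using hzero' m y hy
  · intro x hx
    obtain ⟨m, hm⟩ := hW x hx
    rw [tsum_eq_sum (s := Finset.range (m + 1)) fun k hk => hzero' m x hm k (by simpa using hk),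
      hsum]
    exact hχW _ m x (by omega) hm

/-- Inner regularity of the total variation along an exhaustion. -/
lemma variationOn_le_iSup {μ : Measure X} {v : X → ℝ} {Ω : Set X} {W : ℕ → Set X}
    (hv : Measurable v) (hΩ : IsOpen Ω) (hWo : ∀ n, IsOpen (W n))
    (hWc : ∀ n, IsCompact (closure (W n))) (hWs : ∀ n, closure (W n) ⊆ W (n + 1))
    (hW : ∀ x ∈ Ω, ∃ n, x ∈ W n) :
    variationOn μ v Ω ≤ ⨆ n, variationOn μ v (W n) := by
  set c := ⨆ n, variationOn μ v (W n) with hc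
  by_cases htop : c = ⊤
  · simp [htop]
  have hmono : Monotone W := monotone_nat_of_le_succ fun n => subset_closure.trans (hWs n)
  have hle : ∀ n, variationOn μ v (W n) ≤ c := fun n => le_iSup (fun n => variationOn μ v (W n)) n
  set S : ℕ → Set X := fun n => W (n + 3) \ closure (W n) with hS
  have hSo : ∀ n, IsOpen (S n) := fun n => (hWo _).sdiff isClosed_closure
  have hstep : ∀ n, variationOn μ v (S n) + variationOn μ v (W n) ≤ variationOn μ v (W (n + 3)) :=
    fun n => variationOn_add_le sdiff_subset (hmono (by omega))
      (disjoint_sdiff_left.mono_right subset_closure) (hWo n)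
  have hsum : ∀ N, ∑ n ∈ Finset.range N, variationOn μ v (S n) ≤
      variationOn μ v (W N) + variationOn μ v (W (N + 1)) + variationOn μ v (W (N + 2)) := by
    intro N
    induction N with
    | zero => simp
    | succ N ih =>
      rw [Finset.sum_range_succ]
      calc _ ≤ variationOn μ v (W N) + variationOn μ v (W (N + 1)) +
            variationOn μ v (W (N + 2)) + variationOn μ v (S N) := add_le_add ih le_rfl
        _ = variationOn μ v (W (N + 1)) + variationOn μ v (W (N + 2)) +
            (variationOn μ v (S N) + variationOn μ v (W N)) := by ring
        _ ≤ _ := add_le_add le_rfl (hstep N)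
  have htsum : ∑' n, variationOn μ v (S n) ≠ ⊤ := by
    refine ne_top_of_le_ne_top (b := c + c + c) (by finiteness)
      (ENNReal.tsum_le_of_sum_range_le fun N => (hsum N).trans ?_)
    gcongr <;> exact hle _
  have hbound : ∀ i, variationOn μ v Ω ≤ c + ∑' k, variationOn μ v (S (k + i)) := by
    intro i
    obtain ⟨φ, hφ⟩ := exists_lipschitzPartition_shells hWo hWc hWs hW i
    refine (hφ.variationOn_le hΩ ?_ hv).trans ?_
    · rintro (_ | k)
      · exact hWo _
      · exact hSo _
    · rw [tsum_eq_zero_add' ENNReal.summable]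
      refine add_le_add (hle _) (le_of_eq ?_)
      simp only [hS, add_comm i]
  have hlim := (ENNReal.tendsto_sum_nat_add _ htsum).const_add c
  rw [add_zero] at hlim
  exact ge_of_tendsto' hlim hbound

lemma variationOn_le_add_of_isCompact {μ : Measure X} {v : X → ℝ} {Ω A B : Set X}
    (hv : Measurable v) (hΩ : IsOpen Ω) (hΩc : IsCompact (closure Ω)) (hA : IsOpen A)
    (hB : IsOpen B) (hsub : closure Ω ⊆ A ∪ B) :
    variationOn μ v Ω ≤ variationOn μ v A + variationOn μ v B := by
  obtain ⟨K₁, K₂, hK₁, hK₂, hKA, hKB, hK⟩ := hΩc.binary_compact_cover hA hB hsub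
  obtain ⟨χ₁, ⟨L₁, hL₁⟩, h₁0, h₁1, h₁K, h₁s, h₁c⟩ := hK₁.exists_lipschitz_cutoff hA hKA
  obtain ⟨χ₂, ⟨L₂, hL₂⟩, h₂0, h₂1, h₂K, h₂s, h₂c⟩ := hK₂.exists_lipschitz_cutoff hB hKB
  let φ : ℕ → X → ℝ
    | 0 => χ₁
    | 1 => fun x => max (χ₁ x) (χ₂ x) - χ₁ x
    | _ => fun _ => 0
  let D : ℕ → Set X
    | 0 => A
    | 1 => B
    | _ => ∅
  have hsupp : tsupport (φ 1) ⊆ tsupport χ₂ := by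
    refine closure_mono fun x hx => ?_
    by_contra hne
    have h2 : χ₂ x = 0 := by simpa using hne
    exact hx (by simp [φ, h2, h₁0 x])
  have hsupp0 : ∀ k, tsupport (φ (k + 2)) = ∅ := fun k => by
    rw [tsupport_eq_empty_iff]; rfl
  have hφ : LipschitzPartition Ω D φ := by
    refine ⟨?_, ?_, ?_, ?_, ?_, ?_, ?_⟩
    · rintro (_ | _ | k) x
      · exact h₁0 x
      · exact sub_nonneg.2 (le_max_left _ _)
      · exact le_rfl
    · rintro (_ | _ | k) x
      · exact h₁1 x
      · exact (sub_le_self _ (h₁0 x)).trans (max_le (h₁1 x) (h₂1 x))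
      · exact zero_le_one
    · rintro (_ | _ | k)
      · exact ⟨_, hL₁⟩
      · exact ⟨_, (hL₁.max hL₂).sub hL₁⟩
      · exact ⟨0, LipschitzWith.const _⟩
    · rintro (_ | _ | k)
      · exact h₁s
      · exact hsupp.trans h₂s
      · rw [hsupp0]; exact empty_subset _
    · rintro (_ | _ | k)
      · exact h₁c
      · exact h₂c.of_isClosed_subset (isClosed_tsupport _) hsupp
      · rw [hsupp0]; exact isCompact_empty
    · refine fun x _ => ⟨2, Eventually.of_forall fun y k hk => ?_⟩
      obtain ⟨j, rfl⟩ : ∃ j, k = j + 2 := ⟨k - 2, by omega⟩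
      rfl
    · intro x hx
      rw [tsum_eq_sum (s := Finset.range 2)]
      · have : max (χ₁ x) (χ₂ x) = 1 := by
          have hxK : x ∈ K₁ ∪ K₂ := hK ▸ subset_closure hx
          rcases hxK with h | h
          · rw [h₁K x h]; exact max_eq_left (h₂1 x)
          · rw [h₂K x h]; exact max_eq_right (h₁1 x)
        simp [Finset.sum_range_succ, φ, this]
      · intro k hk
        obtain ⟨j, rfl⟩ : ∃ j, k = j + 2 := ⟨k - 2, by simp at hk; omega⟩
        rfl
  refine (hφ.variationOn_le hΩ ?_ hv).trans_eq ?_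
  · rintro (_ | _ | k)
    exacts [hA, hB, isOpen_empty]
  · rw [tsum_eq_sum (s := Finset.range 2)]
    · simp [Finset.sum_range_succ, D]
    · intro k hk
      obtain ⟨j, rfl⟩ : ∃ j, k = j + 2 := ⟨k - 2, by simp at hk; omega⟩
      exact variationOn_empty μ v

lemma variationOn_union_le {μ : Measure X} {v : X → ℝ} {A B : Set X} (hv : Measurable v)
    (hA : IsOpen A) (hB : IsOpen B) :
    variationOn μ v (A ∪ B) ≤ variationOn μ v A + variationOn μ v B := by
  obtain ⟨W, hWo, hWc, hWs, hWΩ, hW⟩ := (hA.union hB).exists_exhaustion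
  refine (variationOn_le_iSup hv (hA.union hB) hWo hWc hWs fun x hx => ?_).trans
    (iSup_le fun n => variationOn_le_add_of_isCompact hv (hWo n) (hWc n) hA hB
      ((hWs n).trans (hWΩ _)))
  obtain ⟨n, hn⟩ := hW {x} isCompact_singleton (singleton_subset_iff.2 hx)
  exact ⟨n, hn rfl⟩

lemma variationOn_add_totalVar_sdiff_le {μ : Measure X} {v : X → ℝ} {A B : Set X}
    (hv : Measurable v) (hA : IsOpen A) (hB : IsOpen B) (hAB : A ⊆ B) :
    variationOn μ v A + totalVar μ v (B \ A) ≤ variationOn μ v B := by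
  obtain ⟨W, hWo, hWc, hWs, hWΩ, hW⟩ := hA.exists_exhaustion
  have h1 : variationOn μ v A ≤ ⨆ n, variationOn μ v (W n) := by
    refine variationOn_le_iSup hv hA hWo hWc hWs fun x hx => ?_
    obtain ⟨n, hn⟩ := hW {x} isCompact_singleton (singleton_subset_iff.2 hx)
    exact ⟨n, hn rfl⟩
  refine (add_le_add h1 le_rfl).trans ?_
  rw [ENNReal.iSup_add]
  refine iSup_le fun n => ?_
  have hD : IsOpen (B \ closure (W n)) := hB.sdiff isClosed_closure
  have h2 : totalVar μ v (B \ A) ≤ variationOn μ v (B \ closure (W n)) :=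
    iInf₂_le _ ⟨hD, sdiff_subset_sdiff_right ((hWs n).trans (hWΩ _))⟩
  exact (add_le_add le_rfl h2).trans (variationOn_add_le ((hWΩ n).trans hAB) sdiff_subset
    (disjoint_sdiff_right.mono_left subset_closure) hD)

lemma variationOn_le_add_totalVar_sdiff {μ : Measure X} {v : X → ℝ} {A B : Set X}
    (hv : Measurable v) (hA : IsOpen A) :
    variationOn μ v B ≤ variationOn μ v A + totalVar μ v (B \ A) := by
  simp only [totalVar, ENNReal.add_iInf]
  refine le_iInf₂ fun C hC => (variationOn_mono ?_).trans (variationOn_union_le hv hA hC.1)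
  exact fun x hx => (em (x ∈ A)).imp id fun h => hC.2 ⟨hx, h⟩

lemma totalVar_fun_add_le {μ : Measure X} {v₁ v₂ : X → ℝ} (hv₁ : Measurable v₁) (A : Set X) :
    totalVar μ (fun x => v₁ x + v₂ x) A ≤ totalVar μ v₁ A + totalVar μ v₂ A := by
  refine ENNReal.le_of_forall_pos_le_add fun ε hε hfin => ?_
  obtain ⟨h1, h2⟩ := ENNReal.add_lt_top.1 hfin
  have hε2 : (ε : ℝ≥0∞) / 2 ≠ 0 := (ENNReal.half_pos (by exact_mod_cast hε.ne')).ne'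
  have key : ∀ v : X → ℝ, totalVar μ v A < ⊤ →
      ∃ B, (IsOpen B ∧ A ⊆ B) ∧ variationOn μ v B < totalVar μ v A + ε / 2 := fun v hv => by
    have := ENNReal.lt_add_right hv.ne hε2
    conv_lhs at this => rw [totalVar]
    simpa only [iInf_lt_iff, exists_prop] using this
  obtain ⟨B₁, ⟨hB₁, hA₁⟩, hlt₁⟩ := key v₁ h1
  obtain ⟨B₂, ⟨hB₂, hA₂⟩, hlt₂⟩ := key v₂ h2
  calc _ ≤ variationOn μ (fun x => v₁ x + v₂ x) (B₁ ∩ B₂) :=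
        iInf₂_le _ ⟨hB₁.inter hB₂, subset_inter hA₁ hA₂⟩
    _ ≤ variationOn μ v₁ (B₁ ∩ B₂) + variationOn μ v₂ (B₁ ∩ B₂) :=
        variationOn_fun_add_le (hB₁.inter hB₂) hv₁
    _ ≤ variationOn μ v₁ B₁ + variationOn μ v₂ B₂ :=
        add_le_add (variationOn_mono inter_subset_left) (variationOn_mono inter_subset_right)
    _ ≤ (totalVar μ v₁ A + ε / 2) + (totalVar μ v₂ A + ε / 2) := add_le_add hlt₁.le hlt₂.le
    _ = _ := by rw [add_add_add_comm, ENNReal.add_halves]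

lemma perimeter_mono {μ : Measure X} (E : Set X) {A B : Set X} (hAB : A ⊆ B) :
    perimeter μ E A ≤ perimeter μ E B :=
  le_iInf₂ fun C hC => iInf₂_le C ⟨hC.1, hAB.trans hC.2⟩

lemma perimeter_union_le {μ : Measure X} {F G : Set X} (hF : MeasurableSet F)
    (hFG : Disjoint F G) (A : Set X) :
    perimeter μ (F ∪ G) A ≤ perimeter μ F A + perimeter μ G A := by
  unfold perimeter
  rw [indicator_union_of_disjoint hFG]
  exact totalVar_fun_add_le (measurable_const.indicator hF) A

lemma perimeter_add_perimeter_sdiff {μ : Measure X} {E A B : Set X} (hE : MeasurableSet E)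
    (hA : IsOpen A) (hB : IsOpen B) (hAB : A ⊆ B) :
    perimeter μ E A + perimeter μ E (B \ A) = perimeter μ E B := by
  have hm : Measurable (E.indicator fun _ => (1 : ℝ)) := measurable_const.indicator hE
  unfold perimeter
  rw [totalVar_of_isOpen hA, totalVar_of_isOpen hB]
  exact le_antisymm (variationOn_add_totalVar_sdiff_le hm hA hB hAB)
    (variationOn_le_add_totalVar_sdiff hm hA)

end Approximation

/-- **Lemma 4.4 (Lemma 2.11 of BPR).** If `E ⊆ W' ⊆ W` with `W', W` open and `E`
is indecomposable in `W'`, then `E` is indecomposable in `W`. -/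
theorem indecomposable_in_larger_open_set
    [ProperSpace X] (μ : Measure X)
    (hball : ∀ (x : X) (r : ℝ), 0 < r → 0 < μ (ball x r) ∧ μ (ball x r) < ⊤)
    (E : Set X) (hE : MeasurableSet E) (hEfin : perimeter μ E Set.univ < ⊤)
    (W' W : Set X) (hW' : IsOpen W') (hW : IsOpen W)
    (hEW' : E ⊆ W') (hsub : W' ⊆ W)
    (hindec : IsIndecomposableIn μ E W') :
    IsIndecomposableIn μ E W := by
  rintro ⟨F, G, hF, hG, hFG, hunion, hFfin, hGfin, hF0, hG0, hsum⟩
  rw [inter_eq_left.2 (hEW'.trans hsub)] at hunion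
  refine hindec ⟨F, G, hF, hG, hFG, by rw [hunion, inter_eq_left.2 hEW'],
    (perimeter_mono F hsub).trans_lt hFfin, (perimeter_mono G hsub).trans_lt hGfin, hF0, hG0, ?_⟩
  have hsubadd : ∀ A, perimeter μ E A ≤ perimeter μ F A + perimeter μ G A := fun A =>
    hunion ▸ perimeter_union_le hF hFG A
  refine le_antisymm (hsubadd W') ?_
  rw [← perimeter_add_perimeter_sdiff hE hW' hW hsub,
    ← perimeter_add_perimeter_sdiff hF hW' hW hsub,
    ← perimeter_add_perimeter_sdiff hG hW' hW hsub, add_add_add_comm] at hsum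
  have hFC : perimeter μ F (W \ W') ≠ ⊤ :=
    ((perimeter_mono F sdiff_subset).trans_lt hFfin).ne
  have hGC : perimeter μ G (W \ W') ≠ ⊤ :=
    ((perimeter_mono G sdiff_subset).trans_lt hGfin).ne
  refine (ENNReal.add_le_add_iff_right (ENNReal.add_ne_top.2 ⟨hFC, hGC⟩)).1 ?_
  rw [← hsum]
  exact add_le_add le_rfl (hsubadd _)
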